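/- (Sup-norm bound for the deviation from the circle average, estimate (f*) in Proposition 2.3) For every dimension n ≥ 1 there exist constants ε₀ > 0 and C > 0 with the following property: let f : ℝ² → ℝⁿ be smooth, 2π-periodic in θ, with Δf = 0 at every point where ∇f = 0, and suppose W(f, [s,s+1]×[0,2π]) < ε₀² for every s ∈ [−1,1]. Then sup_{(t,θ) ∈ [0,1]×ℝ} |f(t,θ) − f*(t)| ≤ C (∫_{[−1,2]×[0,2π]} |∇f|²)^{1/2}, where f*(t) = (1/2π)∫₀^{2π} f(t,θ) dθ. -/

import Mathlib

open MeasureTheory Set Filter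
open scoped ENNReal Real RealInnerProductSpace

/-- Partial derivative in the first coordinate direction. -/
noncomputable def pd1 {n : ℕ} (f : ℝ × ℝ → EuclideanSpace ℝ (Fin n)) (z : ℝ × ℝ) :
    EuclideanSpace ℝ (Fin n) := fderiv ℝ f z (1, 0)

/-- Partial derivative in the second coordinate direction. -/
noncomputable def pd2 {n : ℕ} (f : ℝ × ℝ → EuclideanSpace ℝ (Fin n)) (z : ℝ × ℝ) :
    EuclideanSpace ℝ (Fin n) := fderiv ℝ f z (0, 1)

/-- `|∇f|²`. -/
noncomputable def gradSq {n : ℕ} (f : ℝ × ℝ → EuclideanSpace ℝ (Fin n)) (z : ℝ × ℝ) : ℝ :=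
    ‖pd1 f z‖ ^ 2 + ‖pd2 f z‖ ^ 2

/-- The Laplacian `Δf = ∂²f/∂x² + ∂²f/∂y²`. -/
noncomputable def lap {n : ℕ} (f : ℝ × ℝ → EuclideanSpace ℝ (Fin n)) (z : ℝ × ℝ) :
    EuclideanSpace ℝ (Fin n) := pd1 (pd1 f) z + pd2 (pd2 f) z

/-- The Willmore energy `W(f, Ω) = ∫_{Ω ∩ {∇f ≠ 0}} |Δf|²/|∇f|²`. -/
noncomputable def willmore {n : ℕ} (f : ℝ × ℝ → EuclideanSpace ℝ (Fin n))
    (Ω : Set (ℝ × ℝ)) : ℝ≥0∞ :=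
  ∫⁻ z in Ω ∩ {w | gradSq f w ≠ 0}, ENNReal.ofReal (‖lap f z‖ ^ 2 / gradSq f z)

/-- The circle average `f*(t) = (1/2π) ∫₀^{2π} f(t,θ) dθ`. -/
noncomputable def circAvg {n : ℕ} (f : ℝ × ℝ → EuclideanSpace ℝ (Fin n)) (t : ℝ) :
    EuclideanSpace ℝ (Fin n) := (2 * π)⁻¹ • ∫ θ in (0:ℝ)..(2 * π), f (t, θ)

section Calculus

variable {n : ℕ} {f : ℝ × ℝ → EuclideanSpace ℝ (Fin n)}

lemma contDiff_pd1 (hf : ContDiff ℝ (⊤ : ℕ∞) f) : ContDiff ℝ (⊤ : ℕ∞) (pd1 f) :=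
  (hf.fderiv_right (m := (⊤ : ℕ∞)) (by simp)).clm_apply contDiff_const

lemma contDiff_pd2 (hf : ContDiff ℝ (⊤ : ℕ∞) f) : ContDiff ℝ (⊤ : ℕ∞) (pd2 f) :=
  (hf.fderiv_right (m := (⊤ : ℕ∞)) (by simp)).clm_apply contDiff_const

lemma continuous_gradSq (hf : ContDiff ℝ (⊤ : ℕ∞) f) : Continuous (gradSq f) :=
  ((contDiff_pd1 hf).continuous.norm.pow 2).add ((contDiff_pd2 hf).continuous.norm.pow 2)

lemma continuous_lap (hf : ContDiff ℝ (⊤ : ℕ∞) f) : Continuous (lap f) :=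
  (contDiff_pd1 (contDiff_pd1 hf)).continuous.add (contDiff_pd2 (contDiff_pd2 hf)).continuous

lemma gradSq_nonneg (z : ℝ × ℝ) : 0 ≤ gradSq f z := by
  unfold gradSq; positivity

lemma fderiv_apply_eq_pd (z v : ℝ × ℝ) :
    fderiv ℝ f z v = v.1 • pd1 f z + v.2 • pd2 f z := by
  have : v = v.1 • ((1, 0) : ℝ × ℝ) + v.2 • ((0, 1) : ℝ × ℝ) := by ext <;> simp
  conv_lhs => rw [this]
  rw [map_add, map_smul, map_smul]
  rfl

lemma fderiv_eq_zero_of_gradSq_eq_zero {z : ℝ × ℝ} (h : gradSq f z = 0) : fderiv ℝ f z = 0 := by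
  unfold gradSq at h
  have h1 : ‖pd1 f z‖ = 0 := by nlinarith [sq_nonneg ‖pd1 f z‖, sq_nonneg ‖pd2 f z‖]
  have h2 : ‖pd2 f z‖ = 0 := by nlinarith [sq_nonneg ‖pd1 f z‖, sq_nonneg ‖pd2 f z‖]
  refine ContinuousLinearMap.ext fun v => ?_
  rw [fderiv_apply_eq_pd, norm_eq_zero.1 h1, norm_eq_zero.1 h2]
  simp

lemma norm_fderiv_apply_sq_le (z v : ℝ × ℝ) :
    ‖fderiv ℝ f z v‖ ^ 2 ≤ (v.1 ^ 2 + v.2 ^ 2) * gradSq f z := by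
  have h : ‖fderiv ℝ f z v‖ ≤ |v.1| * ‖pd1 f z‖ + |v.2| * ‖pd2 f z‖ := by
    rw [fderiv_apply_eq_pd]
    refine (norm_add_le _ _).trans_eq ?_
    simp [norm_smul]
  calc ‖fderiv ℝ f z v‖ ^ 2 ≤ (|v.1| * ‖pd1 f z‖ + |v.2| * ‖pd2 f z‖) ^ 2 := by gcongr
    _ ≤ (|v.1| ^ 2 + |v.2| ^ 2) * gradSq f z := by
      unfold gradSq
      nlinarith [sq_nonneg (|v.1| * ‖pd2 f z‖ - |v.2| * ‖pd1 f z‖)]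
    _ = _ := by simp only [sq_abs]

lemma hasDerivAt_comp_fst (hf : ContDiff ℝ (⊤ : ℕ∞) f) (x y : ℝ) :
    HasDerivAt (fun x => f (x, y)) (pd1 f (x, y)) x := by
  have h := ((hf.differentiable (by simp)) (x, y)).hasFDerivAt
  exact h.comp_hasDerivAt x ((hasDerivAt_id x).prodMk (hasDerivAt_const x y))

lemma hasDerivAt_comp_snd (hf : ContDiff ℝ (⊤ : ℕ∞) f) (x y : ℝ) :
    HasDerivAt (fun y => f (x, y)) (pd2 f (x, y)) y := by
  have h := ((hf.differentiable (by simp)) (x, y)).hasFDerivAt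
  exact h.comp_hasDerivAt y ((hasDerivAt_const y x).prodMk (hasDerivAt_id y))

/-- A Caccioppoli-type identity: the divergence theorem for `⟪f - v, ∇f⟫` on a rectangle. -/
lemma integral_gradSq_add_inner_lap (hf : ContDiff ℝ (⊤ : ℕ∞) f)
    (v : EuclideanSpace ℝ (Fin n)) (a b c d : ℝ) :
    ∫ x in a..b, ∫ y in c..d, (gradSq f (x, y) + ⟪f (x, y) - v, lap f (x, y)⟫) =
      (∫ x in a..b, ⟪f (x, d) - v, pd2 f (x, d)⟫) - (∫ x in a..b, ⟪f (x, c) - v, pd2 f (x, c)⟫)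
        + (∫ y in c..d, ⟪f (b, y) - v, pd1 f (b, y)⟫)
        - ∫ y in c..d, ⟪f (a, y) - v, pd1 f (a, y)⟫ := by
  have hc1 : ContDiff ℝ (⊤ : ℕ∞) fun z => ⟪f z - v, pd1 f z⟫ :=
    (hf.sub contDiff_const).inner ℝ (contDiff_pd1 hf)
  have hc2 : ContDiff ℝ (⊤ : ℕ∞) fun z => ⟪f z - v, pd2 f z⟫ :=
    (hf.sub contDiff_const).inner ℝ (contDiff_pd2 hf)
  have hd : ∀ z, DifferentiableAt ℝ (fun z => f z - v) z := fun z =>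
    (hf.differentiable (by simp) z).sub_const v
  have key : ∀ z, fderiv ℝ (fun z => ⟪f z - v, pd1 f z⟫) z (1, 0)
      + fderiv ℝ (fun z => ⟪f z - v, pd2 f z⟫) z (0, 1)
      = gradSq f z + ⟪f z - v, lap f z⟫ := by
    intro z
    rw [fderiv_inner_apply ℝ (hd z) ((contDiff_pd1 hf).differentiable (by simp) z),
      fderiv_inner_apply ℝ (hd z) ((contDiff_pd2 hf).differentiable (by simp) z)]
    simp only [fderiv_sub_const]
    change ⟪f z - v, pd1 (pd1 f) z⟫ + ⟪pd1 f z, pd1 f z⟫ +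
      (⟪f z - v, pd2 (pd2 f) z⟫ + ⟪pd2 f z, pd2 f z⟫) = _
    rw [lap, inner_add_right, gradSq, real_inner_self_eq_norm_sq, real_inner_self_eq_norm_sq]
    ring
  simp only [← key]
  refine integral2_divergence_prod_of_hasFDerivAt_off_countable _ _ _ _ a c b d ∅ (by simp)
    hc1.continuous.continuousOn hc2.continuous.continuousOn
    (fun z _ => (hc1.differentiable (by simp) z).hasFDerivAt)
    (fun z _ => (hc2.differentiable (by simp) z).hasFDerivAt) ?_
  simp only [key]
  exact ((continuous_gradSq hf).add ((hf.continuous.sub continuous_const).inner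
    (continuous_lap hf))).continuousOn.integrableOn_compact (isCompact_uIcc.prod isCompact_uIcc)

end Calculus

section Integrals

lemma integrableOn_rect {G : ℝ × ℝ → ℝ} (hG : Continuous G) (a b c d : ℝ) :
    IntegrableOn G (Icc a b ×ˢ Icc c d) :=
  hG.continuousOn.integrableOn_compact (isCompact_Icc.prod isCompact_Icc)

lemma setIntegral_rect {G : ℝ × ℝ → ℝ} (hG : Continuous G) {a b c d : ℝ} (hab : a ≤ b)
    (hcd : c ≤ d) :
    ∫ z in Icc a b ×ˢ Icc c d, G z = ∫ x in a..b, ∫ y in c..d, G (x, y) := by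
  rw [Measure.volume_eq_prod, setIntegral_prod _ (integrableOn_rect hG a b c d),
    intervalIntegral.integral_of_le hab, integral_Icc_eq_integral_Ioc]
  simp only [intervalIntegral.integral_of_le hcd, integral_Icc_eq_integral_Ioc]

lemma setIntegral_rect_swap {G : ℝ × ℝ → ℝ} (hG : Continuous G) {a b c d : ℝ} (hab : a ≤ b)
    (hcd : c ≤ d) :
    ∫ z in Icc a b ×ˢ Icc c d, G z = ∫ y in c..d, ∫ x in a..b, G (x, y) := by
  have h := setIntegral_rect (G := fun z => G z.swap) (hG.comp continuous_swap) hcd hab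
  rw [Measure.volume_eq_prod, setIntegral_prod_swap] at h
  exact h

lemma setIntegral_rect_mono {G : ℝ × ℝ → ℝ} (hG : Continuous G) (h0 : ∀ z, 0 ≤ G z)
    {a b c d : ℝ} {S : Set (ℝ × ℝ)} (hS : S ⊆ Icc a b ×ˢ Icc c d) :
    ∫ z in S, G z ≤ ∫ z in Icc a b ×ˢ Icc c d, G z :=
  setIntegral_mono_set (integrableOn_rect hG a b c d) (ae_of_all _ h0) hS.eventuallyLE

lemma sq_setIntegral_le {α : Type*} [MeasurableSpace α] {μ : Measure α} {u : α → ℝ}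
    [IsFiniteMeasure μ] (hu : Integrable u μ) (hu2 : Integrable (fun x => u x ^ 2) μ) :
    (∫ x, u x ∂μ) ^ 2 ≤ μ.real univ * ∫ x, u x ^ 2 ∂μ := by
  set T := μ.real univ
  set S := ∫ x, u x ∂μ with hS
  have hT : 0 ≤ T := measureReal_nonneg
  have h : 0 ≤ ∫ x, (T * u x - S) ^ 2 ∂μ := integral_nonneg fun x => sq_nonneg _
  have e : ∫ x, (T * u x - S) ^ 2 ∂μ = T * (T * (∫ x, u x ^ 2 ∂μ) - S ^ 2) := by
    have : ∀ x, (T * u x - S) ^ 2 = T ^ 2 * u x ^ 2 - (2 * T * S) * u x + S ^ 2 := fun x => by ring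
    simp only [this]
    have h1 : Integrable (fun x => T ^ 2 * u x ^ 2 - 2 * T * S * u x) μ :=
      (hu2.const_mul _).sub (hu.const_mul _)
    rw [integral_add h1 (integrable_const _), integral_sub (hu2.const_mul _) (hu.const_mul _),
      integral_const_mul, integral_const_mul, integral_const, ← hS, smul_eq_mul]
    ring
  rw [e] at h
  rcases hT.eq_or_lt with h0 | h0
  · have : μ = 0 := by
      rw [← Measure.measure_univ_eq_zero]
      exact (measureReal_eq_zero_iff).1 h0.symm
    simp [hS, this]
  · have := nonneg_of_mul_nonneg_right h h0
    linarith

lemma intervalIntegral_le_sqrt {k G : ℝ → ℝ} (hk : Continuous k) (hG : Continuous G)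
    (hkG : ∀ x, k x ^ 2 ≤ G x) {a b l M : ℝ} (hab : a ≤ b) (hl : b - a ≤ l)
    (hM : ∫ x in a..b, G x ≤ M) : ∫ x in a..b, k x ≤ √(l * M) := by
  apply Real.le_sqrt_of_sq_le
  have h := sq_setIntegral_le (μ := volume.restrict (Ioc a b)) (u := k)
    (hk.integrableOn_Ioc) ((hk.pow 2).integrableOn_Ioc)
  rw [← intervalIntegral.integral_of_le hab, ← intervalIntegral.integral_of_le hab] at h
  have h2 : ∫ x in a..b, k x ^ 2 ≤ ∫ x in a..b, G x :=
    intervalIntegral.integral_mono_on hab ((hk.pow 2).intervalIntegrable _ _)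
      (hG.intervalIntegrable _ _) fun x _ => hkG x
  have h0 : 0 ≤ ∫ x in a..b, k x ^ 2 :=
    intervalIntegral.integral_nonneg hab fun x _ => sq_nonneg _
  have e : (volume.restrict (Ioc a b)).real univ = b - a := by
    simp [measureReal_def, hab]
  rw [e] at h
  calc _ ≤ _ := h
    _ ≤ l * M := mul_le_mul hl (h2.trans hM) h0 (by linarith)

lemma exists_mul_le_intervalIntegral {V : ℝ → ℝ} (hV : Continuous V) {a b : ℝ} (hab : a < b) :
    ∃ x ∈ Icc a b, (b - a) * V x ≤ ∫ x in a..b, V x := by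
  by_contra! h
  obtain ⟨x₀, hx₀, hmin⟩ := isCompact_Icc.exists_isMinOn (nonempty_Icc.2 hab.le) hV.continuousOn
  have : ∫ x in a..b, V x₀ ≤ ∫ x in a..b, V x :=
    intervalIntegral.integral_mono_on hab.le (by simp) (hV.intervalIntegrable _ _)
      fun x hx => hmin hx
  rw [intervalIntegral.integral_const, smul_eq_mul] at this
  exact absurd this (not_le.2 (h x₀ hx₀))

lemma continuous_integral_snd {G : ℝ × ℝ → ℝ} (hG : Continuous G) (c d : ℝ) :
    Continuous fun x => ∫ y in c..d, G (x, y) :=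
  intervalIntegral.continuous_parametric_intervalIntegral_of_continuous'
    (f := fun x y => G (x, y)) hG c d

lemma continuous_integral_fst {G : ℝ × ℝ → ℝ} (hG : Continuous G) (a b : ℝ) :
    Continuous fun y => ∫ x in a..b, G (x, y) :=
  continuous_integral_snd (G := fun z => G z.swap) (hG.comp continuous_swap) a b

lemma setIntegral_rect_split_fst {G : ℝ × ℝ → ℝ} (hG : Continuous G) {a m b c d : ℝ}
    (h1 : a ≤ m) (h2 : m ≤ b) (hcd : c ≤ d) :
    ∫ z in Icc a b ×ˢ Icc c d, G z =
      (∫ z in Icc a m ×ˢ Icc c d, G z) + ∫ z in Icc m b ×ˢ Icc c d, G z := by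
  rw [setIntegral_rect hG (h1.trans h2) hcd, setIntegral_rect hG h1 hcd,
    setIntegral_rect hG h2 hcd]
  exact (intervalIntegral.integral_add_adjacent_intervals
    ((continuous_integral_snd hG c d).intervalIntegrable _ _)
    ((continuous_integral_snd hG c d).intervalIntegrable _ _)).symm

lemma setIntegral_rect_split_snd {G : ℝ × ℝ → ℝ} (hG : Continuous G) {a b c m d : ℝ}
    (hab : a ≤ b) (h1 : c ≤ m) (h2 : m ≤ d) :
    ∫ z in Icc a b ×ˢ Icc c d, G z =
      (∫ z in Icc a b ×ˢ Icc c m, G z) + ∫ z in Icc a b ×ˢ Icc m d, G z := by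
  rw [setIntegral_rect_swap hG hab (h1.trans h2), setIntegral_rect_swap hG hab h1,
    setIntegral_rect_swap hG hab h2]
  exact (intervalIntegral.integral_add_adjacent_intervals
    ((continuous_integral_fst hG a b).intervalIntegrable _ _)
    ((continuous_integral_fst hG a b).intervalIntegrable _ _)).symm

end Integrals

section Squares

variable {n : ℕ} {f : ℝ × ℝ → EuclideanSpace ℝ (Fin n)}

/-- The closed axis-parallel square with centre `p` and half side length `r`. -/
def square (p : ℝ × ℝ) (r : ℝ) : Set (ℝ × ℝ) :=
  Icc (p.1 - r) (p.1 + r) ×ˢ Icc (p.2 - r) (p.2 + r)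

/-- The Dirichlet energy of `f` on the square with centre `p` and half side length `r`. -/
noncomputable def energy (f : ℝ × ℝ → EuclideanSpace ℝ (Fin n)) (p : ℝ × ℝ) (r : ℝ) : ℝ :=
  ∫ z in square p r, gradSq f z

lemma energy_nonneg (p : ℝ × ℝ) (r : ℝ) : 0 ≤ energy f p r :=
  integral_nonneg fun _ => gradSq_nonneg _

lemma norm_sub_le_integral_pd1 (hf : ContDiff ℝ (⊤ : ℕ∞) f) {a b x : ℝ} (hx : x ∈ Icc a b)
    (y : ℝ) : ‖f (x, y) - f (a, y)‖ ≤ ∫ s in a..b, ‖pd1 f (s, y)‖ := by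
  have hc : Continuous fun s => pd1 f (s, y) := (contDiff_pd1 hf).continuous.comp (by fun_prop)
  rw [← intervalIntegral.integral_eq_sub_of_hasDerivAt
    (fun s _ => hasDerivAt_comp_fst hf s y) (hc.intervalIntegrable _ _)]
  refine (intervalIntegral.norm_integral_le_integral_norm hx.1).trans ?_
  exact intervalIntegral.integral_mono_interval le_rfl hx.1 hx.2
    (ae_of_all _ fun _ => norm_nonneg _) (hc.norm.intervalIntegrable _ _)

lemma norm_sub_le_integral_pd2 (hf : ContDiff ℝ (⊤ : ℕ∞) f) {c d y : ℝ} (hy : y ∈ Icc c d)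
    (x : ℝ) : ‖f (x, y) - f (x, c)‖ ≤ ∫ s in c..d, ‖pd2 f (x, s)‖ := by
  have hc : Continuous fun s => pd2 f (x, s) := (contDiff_pd2 hf).continuous.comp (by fun_prop)
  rw [← intervalIntegral.integral_eq_sub_of_hasDerivAt
    (fun s _ => hasDerivAt_comp_snd hf x s) (hc.intervalIntegrable _ _)]
  refine (intervalIntegral.norm_integral_le_integral_norm hy.1).trans ?_
  exact intervalIntegral.integral_mono_interval le_rfl hy.1 hy.2
    (ae_of_all _ fun _ => norm_nonneg _) (hc.norm.intervalIntegrable _ _)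

lemma abs_intervalIntegral_inner_le {u w : ℝ → EuclideanSpace ℝ (Fin n)} (hu : Continuous u)
    (hw : Continuous w) {a b K L : ℝ} (hab : a ≤ b) (hK : ∀ x ∈ Icc a b, ‖u x‖ ≤ K)
    (hL : ∫ x in a..b, ‖w x‖ ≤ L) (hK0 : 0 ≤ K) : |∫ x in a..b, ⟪u x, w x⟫| ≤ K * L := by
  calc |∫ x in a..b, ⟪u x, w x⟫| ≤ ∫ x in a..b, |⟪u x, w x⟫| :=
        intervalIntegral.abs_integral_le_integral_abs hab
    _ ≤ ∫ x in a..b, K * ‖w x‖ :=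
        intervalIntegral.integral_mono_on hab ((hu.inner hw).abs.intervalIntegrable _ _)
          ((hw.norm.const_mul K).intervalIntegrable _ _) fun x hx =>
            (abs_real_inner_le_norm _ _).trans (by gcongr; exact hK x hx)
    _ = K * ∫ x in a..b, ‖w x‖ := intervalIntegral.integral_const_mul _ _
    _ ≤ K * L := by gcongr

/-- The energy on a rectangle is controlled by the energy on its boundary and the product of the
oscillation with the `L¹` norm of the Laplacian. -/
lemma integral_gradSq_rect_le (hf : ContDiff ℝ (⊤ : ℕ∞) f) {a b c d l M ω : ℝ} (hab : a ≤ b)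
    (hcd : c ≤ d) (hl1 : b - a ≤ l) (hl2 : d - c ≤ l)
    (hMa : ∫ y in c..d, gradSq f (a, y) ≤ M) (hMb : ∫ y in c..d, gradSq f (b, y) ≤ M)
    (hMc : ∫ x in a..b, gradSq f (x, c) ≤ M) (hMd : ∫ x in a..b, gradSq f (x, d) ≤ M)
    (hω : ∀ z ∈ Icc a b ×ˢ Icc c d, ‖f z - f (a, c)‖ ≤ ω) :
    ∫ z in Icc a b ×ˢ Icc c d, gradSq f z ≤
      8 * (l * M) + ω * ∫ z in Icc a b ×ˢ Icc c d, ‖lap f z‖ := by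
  have hg := continuous_gradSq hf
  have hp1 := (contDiff_pd1 hf).continuous
  have hp2 := (contDiff_pd2 hf).continuous
  have hfc := hf.continuous
  have hle1 : ∀ z, ‖pd1 f z‖ ^ 2 ≤ gradSq f z := fun z => by
    unfold gradSq; nlinarith [sq_nonneg ‖pd2 f z‖]
  have hle2 : ∀ z, ‖pd2 f z‖ ^ 2 ≤ gradSq f z := fun z => by
    unfold gradSq; nlinarith [sq_nonneg ‖pd1 f z‖]
  have hM0 : 0 ≤ M := (intervalIntegral.integral_nonneg hcd fun _ _ => gradSq_nonneg _).trans hMa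
  have hl0 : 0 ≤ l := by linarith
  set L := √(l * M) with hL
  have hL0 : 0 ≤ L := Real.sqrt_nonneg _
  have hLL : L * L = l * M := Real.mul_self_sqrt (by positivity)
  have vert : ∀ x, ∫ y in c..d, gradSq f (x, y) ≤ M →
      ∫ y in c..d, ‖pd1 f (x, y)‖ ≤ L ∧ ∫ y in c..d, ‖pd2 f (x, y)‖ ≤ L := fun x hx =>
    ⟨intervalIntegral_le_sqrt (by fun_prop) (by fun_prop) (fun y => hle1 (x, y)) hcd hl2 hx,
      intervalIntegral_le_sqrt (by fun_prop) (by fun_prop) (fun y => hle2 (x, y)) hcd hl2 hx⟩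
  have hori : ∀ y, ∫ x in a..b, gradSq f (x, y) ≤ M →
      ∫ x in a..b, ‖pd1 f (x, y)‖ ≤ L ∧ ∫ x in a..b, ‖pd2 f (x, y)‖ ≤ L := fun y hy =>
    ⟨intervalIntegral_le_sqrt (by fun_prop) (by fun_prop) (fun x => hle1 (x, y)) hab hl1 hy,
      intervalIntegral_le_sqrt (by fun_prop) (by fun_prop) (fun x => hle2 (x, y)) hab hl1 hy⟩
  have oa : ∀ y ∈ Icc c d, ‖f (a, y) - f (a, c)‖ ≤ L := fun y hy =>
    (norm_sub_le_integral_pd2 hf hy a).trans (vert a hMa).2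
  have oc : ∀ x ∈ Icc a b, ‖f (x, c) - f (a, c)‖ ≤ L := fun x hx =>
    (norm_sub_le_integral_pd1 hf hx c).trans (hori c hMc).1
  have ob : ∀ y ∈ Icc c d, ‖f (b, y) - f (a, c)‖ ≤ 2 * L := fun y hy => by
    have h1 := (norm_sub_le_integral_pd2 hf hy b).trans (vert b hMb).2
    have h2 := oc b (right_mem_Icc.2 hab)
    have h3 := norm_sub_le_norm_sub_add_norm_sub (f (b, y)) (f (b, c)) (f (a, c))
    linarith
  have od : ∀ x ∈ Icc a b, ‖f (x, d) - f (a, c)‖ ≤ 2 * L := fun x hx => by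
    have h1 := (norm_sub_le_integral_pd1 hf hx d).trans (hori d hMd).1
    have h2 := oa d (right_mem_Icc.2 hcd)
    have h3 := norm_sub_le_norm_sub_add_norm_sub (f (x, d)) (f (a, d)) (f (a, c))
    linarith
  have id := integral_gradSq_add_inner_lap hf (f (a, c)) a b c d
  have ia := abs_intervalIntegral_inner_le (u := fun y => f (a, y) - f (a, c))
    (w := fun y => pd1 f (a, y)) (by fun_prop) (by fun_prop) hcd
    (fun y hy => (oa y hy).trans (by linarith : L ≤ 2 * L)) (vert a hMa).1 (by positivity)
  have ib := abs_intervalIntegral_inner_le (u := fun y => f (b, y) - f (a, c))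
    (w := fun y => pd1 f (b, y)) (by fun_prop) (by fun_prop) hcd
    ob (vert b hMb).1 (by positivity)
  have ic := abs_intervalIntegral_inner_le (u := fun x => f (x, c) - f (a, c))
    (w := fun x => pd2 f (x, c)) (by fun_prop) (by fun_prop) hab
    (fun x hx => (oc x hx).trans (by linarith : L ≤ 2 * L)) (hori c hMc).2 (by positivity)
  have ie := abs_intervalIntegral_inner_le (u := fun x => f (x, d) - f (a, c))
    (w := fun x => pd2 f (x, d)) (by fun_prop) (by fun_prop) hab
    od (hori d hMd).2 (by positivity)
  have hin : Continuous fun z => ⟪f z - f (a, c), lap f z⟫ :=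
    (hfc.sub continuous_const).inner (continuous_lap hf)
  rw [← setIntegral_rect (G := fun z => gradSq f z + ⟪f z - f (a, c), lap f z⟫) (hg.add hin)
    hab hcd, integral_add (integrableOn_rect hg _ _ _ _) (integrableOn_rect hin _ _ _ _)] at id
  have ig : -(∫ z in Icc a b ×ˢ Icc c d, ⟪f z - f (a, c), lap f z⟫) ≤
      ω * ∫ z in Icc a b ×ˢ Icc c d, ‖lap f z‖ := by
    rw [← integral_neg, ← integral_const_mul]
    refine setIntegral_mono_on (integrableOn_rect hin _ _ _ _).neg
      (integrableOn_rect ((continuous_lap hf).norm.const_mul ω) _ _ _ _)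
      (measurableSet_Icc.prod measurableSet_Icc) fun z hz => ?_
    refine (neg_le_abs _).trans ((abs_real_inner_le_norm _ _).trans ?_)
    gcongr
    exact hω z hz
  rw [abs_le] at ia ib ic ie
  rw [mul_assoc, hLL] at ia ib ic ie
  linarith [ia.1, ib.2, ic.1, ie.2]

/-- The hole-filling inequality. -/
lemma energy_half_le (hf : ContDiff ℝ (⊤ : ℕ∞) f) {p : ℝ × ℝ} {s ω : ℝ} (hs : 0 < s)
    (hω : ∀ z ∈ square p (2 * s), ∀ w ∈ square p (2 * s), ‖f z - f w‖ ≤ ω) :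
    energy f p s ≤ 32 * (energy f p (2 * s) - energy f p s)
      + ω * ∫ z in square p (2 * s), ‖lap f z‖ := by
  obtain ⟨p₁, p₂⟩ := p
  have hg := continuous_gradSq hf
  have h0 : ∀ z, 0 ≤ gradSq f z := gradSq_nonneg
  unfold energy square at *
  dsimp only at *
  set D := (∫ z in Icc (p₁ - 2 * s) (p₁ + 2 * s) ×ˢ Icc (p₂ - 2 * s) (p₂ + 2 * s), gradSq f z)
    - ∫ z in Icc (p₁ - s) (p₁ + s) ×ˢ Icc (p₂ - s) (p₂ + s), gradSq f z with hD
  have hsub : ∀ {a b c d : ℝ}, a ≤ p₁ - s → p₁ + s ≤ b → c ≤ p₂ - s → p₂ + s ≤ d →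
      ∫ z in Icc (p₁ - s) (p₁ + s) ×ˢ Icc (p₂ - s) (p₂ + s), gradSq f z ≤
        ∫ z in Icc a b ×ˢ Icc c d, gradSq f z := fun h1 h2 h3 h4 =>
    setIntegral_rect_mono hg h0 (prod_mono (Icc_subset_Icc h1 h2) (Icc_subset_Icc h3 h4))
  have left : ∫ z in Icc (p₁ - 2 * s) (p₁ - s) ×ˢ Icc (p₂ - 2 * s) (p₂ + 2 * s), gradSq f z
      ≤ D := by
    have h := setIntegral_rect_split_fst hg (a := p₁ - 2 * s) (m := p₁ - s) (b := p₁ + 2 * s)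
      (c := p₂ - 2 * s) (d := p₂ + 2 * s) (by linarith) (by linarith) (by linarith)
    have h' := hsub (a := p₁ - s) (b := p₁ + 2 * s) (c := p₂ - 2 * s) (d := p₂ + 2 * s)
      (by linarith) (by linarith) (by linarith) (by linarith)
    linarith
  have right : ∫ z in Icc (p₁ + s) (p₁ + 2 * s) ×ˢ Icc (p₂ - 2 * s) (p₂ + 2 * s), gradSq f z
      ≤ D := by
    have h := setIntegral_rect_split_fst hg (a := p₁ - 2 * s) (m := p₁ + s) (b := p₁ + 2 * s)
      (c := p₂ - 2 * s) (d := p₂ + 2 * s) (by linarith) (by linarith) (by linarith)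
    have h' := hsub (a := p₁ - 2 * s) (b := p₁ + s) (c := p₂ - 2 * s) (d := p₂ + 2 * s)
      (by linarith) (by linarith) (by linarith) (by linarith)
    linarith
  have bottom : ∫ z in Icc (p₁ - 2 * s) (p₁ + 2 * s) ×ˢ Icc (p₂ - 2 * s) (p₂ - s), gradSq f z
      ≤ D := by
    have h := setIntegral_rect_split_snd hg (c := p₂ - 2 * s) (m := p₂ - s) (d := p₂ + 2 * s)
      (a := p₁ - 2 * s) (b := p₁ + 2 * s) (by linarith) (by linarith) (by linarith)
    have h' := hsub (a := p₁ - 2 * s) (b := p₁ + 2 * s) (c := p₂ - s) (d := p₂ + 2 * s)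
      (by linarith) (by linarith) (by linarith) (by linarith)
    linarith
  have top : ∫ z in Icc (p₁ - 2 * s) (p₁ + 2 * s) ×ˢ Icc (p₂ + s) (p₂ + 2 * s), gradSq f z
      ≤ D := by
    have h := setIntegral_rect_split_snd hg (c := p₂ - 2 * s) (m := p₂ + s) (d := p₂ + 2 * s)
      (a := p₁ - 2 * s) (b := p₁ + 2 * s) (by linarith) (by linarith) (by linarith)
    have h' := hsub (a := p₁ - 2 * s) (b := p₁ + 2 * s) (c := p₂ - 2 * s) (d := p₂ + s)
      (by linarith) (by linarith) (by linarith) (by linarith)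
    linarith
  rw [setIntegral_rect hg (by linarith) (by linarith)] at left right
  rw [setIntegral_rect_swap hg (by linarith) (by linarith)] at bottom top
  obtain ⟨a, ha, hVa⟩ := exists_mul_le_intervalIntegral (continuous_integral_snd hg
    (p₂ - 2 * s) (p₂ + 2 * s)) (a := p₁ - 2 * s) (b := p₁ - s) (by linarith)
  obtain ⟨b, hb, hVb⟩ := exists_mul_le_intervalIntegral (continuous_integral_snd hg
    (p₂ - 2 * s) (p₂ + 2 * s)) (a := p₁ + s) (b := p₁ + 2 * s) (by linarith)
  obtain ⟨c, hc, hVc⟩ := exists_mul_le_intervalIntegral (continuous_integral_fst hg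
    (p₁ - 2 * s) (p₁ + 2 * s)) (a := p₂ - 2 * s) (b := p₂ - s) (by linarith)
  obtain ⟨d, hd, hVd⟩ := exists_mul_le_intervalIntegral (continuous_integral_fst hg
    (p₁ - 2 * s) (p₁ + 2 * s)) (a := p₂ + s) (b := p₂ + 2 * s) (by linarith)
  obtain ⟨ha1, ha2⟩ := ha
  obtain ⟨hb1, hb2⟩ := hb
  obtain ⟨hc1, hc2⟩ := hc
  obtain ⟨hd1, hd2⟩ := hd
  have vert : ∀ x V, V ≤ D → s * (∫ y in (p₂ - 2 * s)..(p₂ + 2 * s), gradSq f (x, y)) ≤ V →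
      ∫ y in c..d, gradSq f (x, y) ≤ D / s := fun x V h1 h2 => by
    have h3 : ∫ y in c..d, gradSq f (x, y) ≤ ∫ y in (p₂ - 2 * s)..(p₂ + 2 * s), gradSq f (x, y) :=
      intervalIntegral.integral_mono_interval hc1 (by linarith) hd2
        (ae_of_all _ fun _ => h0 _)
        ((hg.comp (by fun_prop : Continuous fun y => (x, y))).intervalIntegrable _ _)
    rw [le_div_iff₀ hs]
    nlinarith
  have hori : ∀ y V, V ≤ D → s * (∫ x in (p₁ - 2 * s)..(p₁ + 2 * s), gradSq f (x, y)) ≤ V →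
      ∫ x in a..b, gradSq f (x, y) ≤ D / s := fun y V h1 h2 => by
    have h3 : ∫ x in a..b, gradSq f (x, y) ≤ ∫ x in (p₁ - 2 * s)..(p₁ + 2 * s), gradSq f (x, y) :=
      intervalIntegral.integral_mono_interval ha1 (by linarith) hb2
        (ae_of_all _ fun _ => h0 _)
        ((hg.comp (by fun_prop : Continuous fun x => (x, y))).intervalIntegrable _ _)
    rw [le_div_iff₀ hs]
    nlinarith
  have hsubset : Icc a b ×ˢ Icc c d ⊆
      Icc (p₁ - 2 * s) (p₁ + 2 * s) ×ˢ Icc (p₂ - 2 * s) (p₂ + 2 * s) :=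
    prod_mono (Icc_subset_Icc ha1 hb2) (Icc_subset_Icc hc1 hd2)
  have hac : (a, c) ∈ Icc a b ×ˢ Icc c d :=
    ⟨left_mem_Icc.2 (by linarith), left_mem_Icc.2 (by linarith)⟩
  have main := integral_gradSq_rect_le hf (a := a) (b := b) (c := c) (d := d) (l := 4 * s)
    (M := D / s) (ω := ω) (by linarith) (by linarith) (by linarith) (by linarith)
    (vert a _ left (by convert hVa using 2; ring)) (vert b _ right (by convert hVb using 2; ring))
    (hori c _ bottom (by convert hVc using 2; ring)) (hori d _ top (by convert hVd using 2; ring))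
    (fun z hz => hω z (hsubset hz) _ (hsubset hac))
  have hω0 : 0 ≤ ω := (norm_nonneg _).trans (hω _ (hsubset hac) _ (hsubset hac))
  have hlap := setIntegral_rect_mono (continuous_lap hf).norm (fun z => norm_nonneg (lap f z))
    hsubset
  have e : 8 * (4 * s * (D / s)) = 32 * D := by field_simp; ring
  rw [e] at main
  calc _ ≤ _ := hsub ha2 hb1 hc2 hd1
    _ ≤ _ := main
    _ ≤ _ := by gcongr

end Squares

section Morrey

variable {n : ℕ} {f : ℝ × ℝ → EuclideanSpace ℝ (Fin n)}

lemma setIntegral_square_comp_homothety {G : ℝ × ℝ → ℝ} (hG : Continuous G) (p z : ℝ × ℝ)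
    {r s : ℝ} (hr : 0 ≤ r) (hs : 0 < s) :
    ∫ y in square p r, G (z + s • (y - z)) =
      (s ^ 2)⁻¹ * ∫ y in square (z + s • (p - z)) (s * r), G y := by
  obtain ⟨p₁, p₂⟩ := p
  obtain ⟨z₁, z₂⟩ := z
  have hsr : 0 ≤ s * r := by positivity
  unfold square
  rw [setIntegral_rect (by fun_prop) (by linarith) (by linarith),
    setIntegral_rect hG (by linarith) (by linarith)]
  have e : ∀ x y : ℝ, (z₁, z₂) + s • ((x, y) - (z₁, z₂)) =
      (s * x + (z₁ - s * z₁), s * y + (z₂ - s * z₂)) := fun x y => by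
    ext <;> simp <;> ring
  have inner : ∀ x, ∫ y in (p₂ - r)..(p₂ + r), G (s * x + (z₁ - s * z₁), s * y + (z₂ - s * z₂)) =
      s⁻¹ • ∫ y in (s * (p₂ - r) + (z₂ - s * z₂))..(s * (p₂ + r) + (z₂ - s * z₂)),
        G (s * x + (z₁ - s * z₁), y) := fun x =>
    intervalIntegral.integral_comp_mul_add (fun y => G (s * x + (z₁ - s * z₁), y)) hs.ne' _
  simp only [e, inner]
  rw [intervalIntegral.integral_comp_mul_add (fun x => s⁻¹ • ∫ y in
    (s * (p₂ - r) + (z₂ - s * z₂))..(s * (p₂ + r) + (z₂ - s * z₂)), G (x, y)) hs.ne'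
    (z₁ - s * z₁), intervalIntegral.integral_smul, smul_eq_mul, smul_eq_mul, ← mul_assoc]
  congr 1
  · field_simp
  · congr 1
    · funext x; congr 1 <;> ring
    · ring
    · ring

lemma measureReal_square (p : ℝ × ℝ) {r : ℝ} (hr : 0 ≤ r) :
    volume.real (square p r) = 4 * r ^ 2 := by
  rw [square, Measure.volume_eq_prod, measureReal_prod_prod, Real.volume_real_Icc_of_le,
    Real.volume_real_Icc_of_le] <;> linarith

lemma isCompact_square (p : ℝ × ℝ) (r : ℝ) : IsCompact (square p r) :=
  isCompact_Icc.prod isCompact_Icc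

lemma integrableOn_square {G : ℝ × ℝ → ℝ} (hG : Continuous G) (p : ℝ × ℝ) (r : ℝ) :
    IntegrableOn G (square p r) :=
  hG.continuousOn.integrableOn_compact (isCompact_square p r)

lemma norm_sub_le_integral_segment (hf : ContDiff ℝ (⊤ : ℕ∞) f) (z y : ℝ × ℝ) :
    ‖f y - f z‖ ≤ ∫ s in (0:ℝ)..1, ‖fderiv ℝ f (z + s • (y - z)) (y - z)‖ := by
  have hd : ∀ s : ℝ, HasDerivAt (fun s : ℝ => f (z + s • (y - z)))
      (fderiv ℝ f (z + s • (y - z)) (y - z)) s := fun s => by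
    have h := ((hf.differentiable (by simp)) (z + s • (y - z))).hasFDerivAt
    have h2 : HasDerivAt (fun s : ℝ => z + s • (y - z)) (y - z) s := by
      simpa using ((hasDerivAt_id s).smul_const (y - z)).const_add z
    exact h.comp_hasDerivAt s h2
  have hc : Continuous fun s : ℝ => fderiv ℝ f (z + s • (y - z)) (y - z) :=
    ((hf.continuous_fderiv (by simp)).comp (by fun_prop)).clm_apply continuous_const
  have h := intervalIntegral.integral_eq_sub_of_hasDerivAt (a := 0) (b := 1)
    (fun s _ => hd s) (hc.intervalIntegrable _ _)
  have h' : f y - f z = ∫ s in (0:ℝ)..1, fderiv ℝ f (z + s • (y - z)) (y - z) := by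
    rw [h]; simp
  rw [h']
  exact intervalIntegral.norm_integral_le_integral_norm zero_le_one

lemma setIntegral_norm_fderiv_homothety_le (hf : ContDiff ℝ (⊤ : ℕ∞) f) {p z : ℝ × ℝ}
    {r s B : ℝ} (hr : 0 ≤ r) (hs : 0 < s) (hz : z ∈ square p r)
    (hB : energy f (z + s • (p - z)) (s * r) ≤ B) :
    (∫ y in square p r, ‖fderiv ℝ f (z + s • (y - z)) (y - z)‖) ^ 2 ≤
      32 * r ^ 4 * (B / s ^ 2) := by
  have hg := continuous_gradSq hf
  have hc : Continuous fun y : ℝ × ℝ => ‖fderiv ℝ f (z + s • (y - z)) (y - z)‖ :=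
    (((hf.continuous_fderiv (by simp)).comp (by fun_prop)).clm_apply (by fun_prop)).norm
  have hcomp := isCompact_square p r
  have : IsFiniteMeasure (volume.restrict (square p r)) :=
    ⟨by simpa using hcomp.measure_lt_top⟩
  have h := sq_setIntegral_le (μ := volume.restrict (square p r))
    (integrableOn_square hc p r)
    (integrableOn_square (hc.pow 2) p r)
  rw [measureReal_restrict_apply_univ, measureReal_square p hr] at h
  have h2 : ∫ y in square p r, ‖fderiv ℝ f (z + s • (y - z)) (y - z)‖ ^ 2 ≤
      ∫ y in square p r, 8 * r ^ 2 * gradSq f (z + s • (y - z)) := by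
    refine setIntegral_mono_on (integrableOn_square (hc.pow 2) p r)
      (integrableOn_square (by fun_prop) p r)
      (measurableSet_Icc.prod measurableSet_Icc) fun y hy => ?_
    refine (norm_fderiv_apply_sq_le _ _).trans ?_
    gcongr
    · exact gradSq_nonneg _
    · obtain ⟨⟨_, _⟩, _, _⟩ := hy
      obtain ⟨⟨_, _⟩, _, _⟩ := hz
      have h1 : (y - z).1 ^ 2 ≤ (2 * r) ^ 2 :=
        sq_le_sq' (by simp only [Prod.fst_sub]; linarith) (by simp only [Prod.fst_sub]; linarith)
      have h2 : (y - z).2 ^ 2 ≤ (2 * r) ^ 2 :=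
        sq_le_sq' (by simp only [Prod.snd_sub]; linarith) (by simp only [Prod.snd_sub]; linarith)
      linarith
  rw [integral_const_mul, setIntegral_square_comp_homothety hg p z hr hs] at h2
  calc _ ≤ _ := h
    _ ≤ 4 * r ^ 2 * (8 * r ^ 2 * ((s ^ 2)⁻¹ * B)) := by
        gcongr
        refine h2.trans ?_
        gcongr
        exact hB
    _ = _ := by ring

lemma setIntegral_square_le_of_le_intervalIntegral {g : ℝ × ℝ → ℝ} {φ : ℝ → ℝ × ℝ → ℝ}
    (hg : Continuous g) (hc : Continuous (Function.uncurry φ))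
    (hle : ∀ y, g y ≤ ∫ s in (0:ℝ)..1, φ s y) (p : ℝ × ℝ) (r : ℝ) :
    ∫ y in square p r, g y ≤ ∫ s in (0:ℝ)..1, ∫ y in square p r, φ s y := by
  have hswap : ∫ s in (0:ℝ)..1, ∫ y in square p r, φ s y =
      ∫ y in square p r, ∫ s in (0:ℝ)..1, φ s y := by
    refine intervalIntegral_integral_swap ?_
    rw [Measure.prod_restrict, uIoc_of_le zero_le_one]
    exact (hc.continuousOn.integrableOn_compact
      (isCompact_Icc.prod (isCompact_square p r))).mono_set
      (prod_mono Ioc_subset_Icc_self subset_rfl)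
  have hci : Continuous fun y => ∫ s in (0:ℝ)..1, φ s y :=
    intervalIntegral.continuous_parametric_intervalIntegral_of_continuous'
      (f := fun y s => φ s y) (hc.comp continuous_swap) 0 1
  rw [hswap]
  exact setIntegral_mono_on (integrableOn_square hg p r) (integrableOn_square hci p r)
    (measurableSet_Icc.prod measurableSet_Icc) fun y _ => hle y

lemma setIntegral_norm_sub_le_of_energy_decay (hf : ContDiff ℝ (⊤ : ℕ∞) f) {p z : ℝ × ℝ}
    {r Y a : ℝ} (hz : z ∈ square p r)
    (hr : 0 < r) (ha : 0 < a)
    (hE : ∀ q s, 0 < s → s ≤ r → |q.1 - p.1| ≤ r - s → |q.2 - p.2| ≤ r - s →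
      energy f q s ≤ Y * (s / r) ^ a) :
    ∫ y in square p r, ‖f y - f z‖ ≤ 12 / a * √Y * r ^ 2 := by
  have hfc := hf.continuous
  have hcomp := isCompact_square p r
  have hY : 0 ≤ Y := by
    have h := hE p r hr le_rfl (by simp) (by simp)
    rw [div_self hr.ne', Real.one_rpow, mul_one] at h
    exact (energy_nonneg p r).trans h
  have hc : Continuous fun v : ℝ × ℝ × ℝ =>
      ‖fderiv ℝ f (z + v.1 • (v.2 - z)) (v.2 - z)‖ :=
    (((hf.continuous_fderiv (by simp)).comp (by fun_prop)).clm_apply (by fun_prop)).norm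
  have hcs : Continuous fun s : ℝ =>
      ∫ y in square p r, ‖fderiv ℝ f (z + s • (y - z)) (y - z)‖ :=
    continuous_parametric_integral_of_continuous hc hcomp
  have hexp : -1 < a / 2 - 1 := by linarith
  have hbound : ∀ s ∈ Ioo (0:ℝ) 1,
      ∫ y in square p r, ‖fderiv ℝ f (z + s • (y - z)) (y - z)‖ ≤
        (6 * r ^ 2 * √Y) * s ^ (a / 2 - 1) := by
    intro s hs
    have hs0 := hs.1
    have hs1 := hs.2
    have hzz := hz
    obtain ⟨⟨_, _⟩, _, _⟩ := hzz
    have hq : energy f (z + s • (p - z)) (s * r) ≤ Y * s ^ a := by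
      have h := hE (z + s • (p - z)) (s * r) (by positivity) (by nlinarith)
        (by
          rw [abs_le]
          simp only [Prod.fst_add, Prod.smul_fst, Prod.fst_sub, smul_eq_mul]
          constructor <;> nlinarith)
        (by
          rw [abs_le]
          simp only [Prod.snd_add, Prod.smul_snd, Prod.snd_sub, smul_eq_mul]
          constructor <;> nlinarith)
      rwa [mul_div_assoc, div_self hr.ne', mul_one] at h
    refine abs_le_of_sq_le_sq' ?_ (by positivity) |>.2
    refine (setIntegral_norm_fderiv_homothety_le hf hr.le hs0 hz hq).trans ?_
    have e : (s ^ (a / 2 - 1)) ^ 2 = s ^ a / s ^ 2 := by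
      rw [← Real.rpow_natCast (s ^ (a / 2 - 1)), ← Real.rpow_mul hs0.le, ← Real.rpow_natCast s 2,
        ← Real.rpow_sub hs0]
      congr 1
      push_cast
      ring
    rw [mul_pow, e, mul_pow, mul_pow, Real.sq_sqrt hY]
    have : 0 ≤ r ^ 4 * (Y * s ^ a / s ^ 2) := by positivity
    calc _ ≤ 36 * (r ^ 4 * (Y * s ^ a / s ^ 2)) := by linarith
      _ = _ := by ring
  calc ∫ y in square p r, ‖f y - f z‖ ≤ _ := setIntegral_square_le_of_le_intervalIntegral
        (φ := fun s y => ‖fderiv ℝ f (z + s • (y - z)) (y - z)‖) (by fun_prop) hc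
        (norm_sub_le_integral_segment hf z) p r
    _ ≤ ∫ s in (0:ℝ)..1, (6 * r ^ 2 * √Y) * s ^ (a / 2 - 1) :=
        intervalIntegral.integral_mono_on_of_le_Ioo zero_le_one (hcs.intervalIntegrable _ _)
          ((intervalIntegral.intervalIntegrable_rpow' hexp).const_mul _) hbound
    _ = _ := by
        rw [intervalIntegral.integral_const_mul, integral_rpow (Or.inl hexp)]
        have : a / 2 ≠ 0 := by positivity
        rw [sub_add_cancel, Real.one_rpow, Real.zero_rpow this]
        field_simp
        ring

/-- Morrey's lemma: power decay of the energy on all subsquares bounds the oscillation. -/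
lemma norm_sub_le_of_energy_decay (hf : ContDiff ℝ (⊤ : ℕ∞) f) {p : ℝ × ℝ} {r Y a : ℝ}
    (hr : 0 < r) (ha : 0 < a)
    (hE : ∀ q s, 0 < s → s ≤ r → |q.1 - p.1| ≤ r - s → |q.2 - p.2| ≤ r - s →
      energy f q s ≤ Y * (s / r) ^ a) :
    ∀ z ∈ square p r, ∀ w ∈ square p r, ‖f z - f w‖ ≤ 6 / a * √Y := by
  have hfc := hf.continuous
  have hcomp := isCompact_square p r
  intro z hz w hw
  have hcn : ∀ z, IntegrableOn (fun y => ‖f y - f z‖) (square p r) := fun z =>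
    integrableOn_square (by fun_prop) p r
  have h : ∫ y in square p r, ‖f z - f w‖ ≤ ∫ y in square p r, (‖f y - f z‖ + ‖f y - f w‖) :=
    setIntegral_mono_on (integrableOn_const hcomp.measure_lt_top.ne) ((hcn z).add (hcn w))
      (measurableSet_Icc.prod measurableSet_Icc) fun y _ => by
        have := norm_sub_le_norm_sub_add_norm_sub (f z) (f y) (f w)
        rwa [norm_sub_rev (f z) (f y)] at this
  rw [integral_add (hcn z) (hcn w), setIntegral_const, measureReal_square p hr.le,
    smul_eq_mul] at h
  have h2 : 4 * r ^ 2 * ‖f z - f w‖ ≤ 4 * r ^ 2 * (6 / a * √Y) := by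
    calc _ ≤ _ := h
      _ ≤ 12 / a * √Y * r ^ 2 + 12 / a * √Y * r ^ 2 := add_le_add 
            (setIntegral_norm_sub_le_of_energy_decay hf hz hr ha hE)
            (setIntegral_norm_sub_le_of_energy_decay hf hw hr ha hE)
      _ = _ := by ring
  exact le_of_mul_le_mul_left h2 (by positivity)

end Morrey

section Periodic

variable {n : ℕ} {f : ℝ × ℝ → EuclideanSpace ℝ (Fin n)}

lemma fderiv_periodic {v : ℝ × ℝ} {g : ℝ × ℝ → EuclideanSpace ℝ (Fin n)}
    (h : ∀ z, g (z + v) = g z) (z : ℝ × ℝ) : fderiv ℝ g (z + v) = fderiv ℝ g z := by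
  rw [← fderiv_comp_add_right]
  simp only [h]

lemma gradSq_periodic {v : ℝ × ℝ} (h : ∀ z, f (z + v) = f z) (z : ℝ × ℝ) :
    gradSq f (z + v) = gradSq f z := by
  simp only [gradSq, pd1, pd2, fderiv_periodic h]

lemma lap_periodic {v : ℝ × ℝ} (h : ∀ z, f (z + v) = f z) (z : ℝ × ℝ) :
    lap f (z + v) = lap f z := by
  have h1 : ∀ z, pd1 f (z + v) = pd1 f z := fun z => by simp only [pd1, fderiv_periodic h]
  have h2 : ∀ z, pd2 f (z + v) = pd2 f z := fun z => by simp only [pd2, fderiv_periodic h]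
  change fderiv ℝ (pd1 f) (z + v) (1, 0) + fderiv ℝ (pd2 f) (z + v) (0, 1) = _
  rw [fderiv_periodic h1, fderiv_periodic h2]
  rfl

lemma setLIntegral_strip_translate {T : ℝ} {F : ℝ × ℝ → ℝ≥0∞}
    (hF : ∀ z, F (z + (0, T)) = F z) (I : Set ℝ) (k : ℤ) :
    ∫⁻ z in I ×ˢ Icc (k * T) ((k + 1) * T), F z = ∫⁻ z in I ×ˢ Icc 0 T, F z := by
  have hper : Function.Periodic F (0, T) := hF
  have hk : ∀ z, F (z + (0, k * T)) = F z := fun z => by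
    have := hper.zsmul k z
    rwa [Prod.smul_mk, zsmul_zero, zsmul_eq_mul] at this
  have hmp := measurePreserving_add_right (volume : Measure (ℝ × ℝ)) (0, k * T)
  have hemb := (MeasurableEquiv.addRight ((0, k * T) : ℝ × ℝ)).measurableEmbedding
  rw [← hmp.setLIntegral_comp_preimage_emb hemb]
  simp only [hk]
  congr 2
  ext ⟨x, y⟩
  simp only [mem_preimage, Prod.mk_add_mk, mem_prod, mem_Icc, add_zero]
  constructor <;> rintro ⟨h1, h2, h3⟩ <;> exact ⟨h1, by linarith, by linarith⟩

/-- An interval of length at most one period is covered by two translates of `[0, T]`. -/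
lemma setLIntegral_le_two_mul_of_periodic {T : ℝ} (hT : 0 < T) {F : ℝ × ℝ → ℝ≥0∞}
    (hF : ∀ z, F (z + (0, T)) = F z) (I : Set ℝ) {c d : ℝ} (hcd : d - c ≤ T) :
    ∫⁻ z in I ×ˢ Icc c d, F z ≤ 2 * ∫⁻ z in I ×ˢ Icc 0 T, F z := by
  set k := ⌊c / T⌋ with hk
  have h1 : k * T ≤ c := (le_div_iff₀ hT).1 (Int.floor_le _)
  have h2 : c < (k + 1) * T := (div_lt_iff₀ hT).1 (Int.lt_floor_add_one _)
  have hsub : I ×ˢ Icc c d ⊆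
      I ×ˢ Icc (k * T) ((k + 1) * T) ∪ I ×ˢ Icc ((k + 1 : ℤ) * T) (((k + 1 : ℤ) + 1) * T) := by
    rintro ⟨x, y⟩ ⟨hx, hy1, hy2⟩
    dsimp only at hx hy1 hy2
    push_cast
    rcases le_total y ((k + 1) * T) with h | h
    · exact Or.inl ⟨hx, by linarith, h⟩
    · exact Or.inr ⟨hx, h, by dsimp only; linarith⟩
  calc _ ≤ _ := lintegral_mono_set hsub
    _ ≤ _ := lintegral_union_le _ _ _
    _ = _ := by
      rw [setLIntegral_strip_translate hF I k, setLIntegral_strip_translate hF I (k + 1), two_mul]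

lemma willmore_eq (hf : ContDiff ℝ (⊤ : ℕ∞) f) (Ω : Set (ℝ × ℝ)) :
    willmore f Ω = ∫⁻ z in Ω, ENNReal.ofReal (‖lap f z‖ ^ 2 / gradSq f z) := by
  have hA : MeasurableSet {w | gradSq f w ≠ 0} :=
    (isOpen_ne_fun (continuous_gradSq hf) continuous_const).measurableSet
  rw [willmore, inter_comm, ← setLIntegral_indicator hA]
  congr 1
  funext z
  by_cases h : gradSq f z = 0
  · simp [h]
  · exact indicator_of_mem (s := {w | gradSq f w ≠ 0}) h _

lemma setIntegral_norm_lap_le (hf : ContDiff ℝ (⊤ : ℕ∞) f)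
    (hper : ∀ z, f (z + (0, 2 * π)) = f z) (hz : ∀ z, fderiv ℝ f z = 0 → lap f z = 0) {ε : ℝ}
    (hε : 0 < ε)
    (hW : ∀ s ∈ Icc (-1 : ℝ) 1,
      willmore f (Icc s (s + 1) ×ˢ Icc 0 (2 * π)) < ENNReal.ofReal (ε ^ 2))
    {p : ℝ × ℝ} {r Y : ℝ} (hr : 2 * r ≤ 1) (hp1 : -1 ≤ p.1 - r) (hp2 : p.1 + r ≤ 2)
    (hY : 0 < Y) (hE : energy f p r ≤ Y) :
    ∫ z in square p r, ‖lap f z‖ ≤ 2 * ε * √Y := by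
  have hg := continuous_gradSq hf
  set lam := √Y / ε with hlam
  have hlam0 : 0 < lam := by positivity
  have hpt : ∀ z, ‖lap f z‖ ≤ lam / 2 * (‖lap f z‖ ^ 2 / gradSq f z) + gradSq f z / (2 * lam) := by
    intro z
    by_cases h : gradSq f z = 0
    · simp [h, hz z (fderiv_eq_zero_of_gradSq_eq_zero h)]
    · have h0 : 0 < gradSq f z := lt_of_le_of_ne (gradSq_nonneg z) (Ne.symm h)
      rw [← sub_nonneg]
      have : lam / 2 * (‖lap f z‖ ^ 2 / gradSq f z) + gradSq f z / (2 * lam) - ‖lap f z‖ =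
          (lam * ‖lap f z‖ - gradSq f z) ^ 2 / (2 * lam * gradSq f z) := by
        field_simp
        ring
      rw [this]
      positivity
  have hWsq : ∫⁻ z in square p r, ENNReal.ofReal (‖lap f z‖ ^ 2 / gradSq f z) ≤
      2 * ENNReal.ofReal (ε ^ 2) := by
    have hs : min (p.1 - r) 1 ∈ Icc (-1 : ℝ) 1 := ⟨le_min hp1 (by norm_num), min_le_right _ _⟩
    have h1 := hW _ hs
    rw [willmore_eq hf] at h1
    have hI : Icc (p.1 - r) (p.1 + r) ⊆ Icc (min (p.1 - r) 1) (min (p.1 - r) 1 + 1) := by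
      refine Icc_subset_Icc (min_le_left _ _) ?_
      rcases min_choice (p.1 - r) 1 with h | h <;> rw [h] <;> linarith
    calc _ ≤ _ := lintegral_mono_set (prod_mono hI subset_rfl)
      _ ≤ _ := setLIntegral_le_two_mul_of_periodic Real.two_pi_pos (fun z => by
          rw [lap_periodic hper, gradSq_periodic hper]) _ (by linarith [Real.pi_gt_three])
      _ ≤ _ := by gcongr
  have hfin : ENNReal.ofReal (∫ z in square p r, ‖lap f z‖) ≤
      ENNReal.ofReal (lam * ε ^ 2 + energy f p r / (2 * lam)) := by
    rw [ofReal_integral_eq_lintegral_ofReal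
      (integrableOn_square (continuous_lap hf).norm p r) (ae_of_all _ fun _ => norm_nonneg _)]
    calc ∫⁻ z in square p r, ENNReal.ofReal ‖lap f z‖
        ≤ ∫⁻ z in square p r, (ENNReal.ofReal (lam / 2) *
            ENNReal.ofReal (‖lap f z‖ ^ 2 / gradSq f z) +
            ENNReal.ofReal (gradSq f z / (2 * lam))) := by
          refine lintegral_mono fun z => ?_
          rw [← ENNReal.ofReal_mul (by positivity), ← ENNReal.ofReal_add]
          · exact ENNReal.ofReal_le_ofReal (hpt z)
          · have := gradSq_nonneg (f := f) z
            positivity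
          · have := gradSq_nonneg (f := f) z
            positivity
      _ = ENNReal.ofReal (lam / 2) * (∫⁻ z in square p r,
            ENNReal.ofReal (‖lap f z‖ ^ 2 / gradSq f z)) +
            ENNReal.ofReal (energy f p r / (2 * lam)) := by
          rw [lintegral_add_right _ (by fun_prop), lintegral_const_mul' _ _ ENNReal.ofReal_ne_top,
            ← ofReal_integral_eq_lintegral_ofReal (integrableOn_square (by fun_prop) p r)
              (ae_of_all _ fun z => div_nonneg (gradSq_nonneg z) (by positivity)),
            integral_div, energy]
      _ ≤ ENNReal.ofReal (lam / 2) * (2 * ENNReal.ofReal (ε ^ 2)) +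
            ENNReal.ofReal (energy f p r / (2 * lam)) := by gcongr
      _ = _ := by
          have := energy_nonneg (f := f) p r
          rw [← ENNReal.ofReal_ofNat 2, ← ENNReal.ofReal_mul (by positivity),
            ← ENNReal.ofReal_mul (by positivity), ← ENNReal.ofReal_add (by positivity)
              (by positivity)]
          congr 1
          ring
  have h0 : 0 ≤ energy f p r := energy_nonneg p r
  rw [ENNReal.ofReal_le_ofReal_iff (by positivity)] at hfin
  have hsq : √Y * √Y = Y := Real.mul_self_sqrt hY.le
  have e1 : lam * ε ^ 2 = ε * √Y := by rw [hlam]; field_simp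
  have e2 : energy f p r / (2 * lam) ≤ ε * √Y / 2 := by
    rw [div_le_iff₀ (by positivity), hlam]
    calc _ ≤ Y := hE
      _ = √Y * √Y := hsq.symm
      _ = _ := by field_simp
  have : 0 < ε * √Y := by positivity
  linarith

/-- The energy on the strip `[-1, 2]` over one period. -/
lemma energy_le_two_mul_strip (hf : ContDiff ℝ (⊤ : ℕ∞) f)
    (hper : ∀ z, f (z + (0, 2 * π)) = f z) {p : ℝ × ℝ} {r : ℝ}
    (hp1 : -1 ≤ p.1 - r) (hp2 : p.1 + r ≤ 2) :
    energy f p r ≤ 2 * ∫ z in Icc (-1 : ℝ) 2 ×ˢ Icc 0 (2 * π), gradSq f z := by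
  have hg := continuous_gradSq hf
  have h0 : 0 ≤ ∫ z in Icc (-1 : ℝ) 2 ×ˢ Icc 0 (2 * π), gradSq f z :=
    integral_nonneg fun _ => gradSq_nonneg _
  rw [← ENNReal.ofReal_le_ofReal_iff (by positivity), energy,
    ofReal_integral_eq_lintegral_ofReal (integrableOn_square hg p r)
      (ae_of_all _ fun _ => gradSq_nonneg _),
    ENNReal.ofReal_mul (by norm_num), ofReal_integral_eq_lintegral_ofReal
      (integrableOn_rect hg _ _ _ _) (ae_of_all _ fun _ => gradSq_nonneg _),
    ENNReal.ofReal_ofNat]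
  calc _ ≤ _ := lintegral_mono_set (prod_mono (Icc_subset_Icc hp1 hp2) subset_rfl)
    _ ≤ _ := setLIntegral_le_two_mul_of_periodic Real.two_pi_pos (fun z => by
        rw [gradSq_periodic hper]) _ (by linarith [Real.pi_gt_three])

end Periodic

section Decay

variable {n : ℕ} {f : ℝ × ℝ → EuclideanSpace ℝ (Fin n)}

/-- The distance from `t` to the complement of the interval `[-1, 2]`, for `t` in this interval. -/
def bdryDist (t : ℝ) : ℝ := min (t + 1) (2 - t)

lemma bdryDist_sub_abs_le (t s : ℝ) : bdryDist t - |s - t| ≤ bdryDist s := by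
  have h1 := neg_abs_le (s - t)
  have h2 := le_abs_self (s - t)
  have h3 : bdryDist t ≤ t + 1 := min_le_left _ _
  have h4 : bdryDist t ≤ 2 - t := min_le_right _ _
  exact le_min (by linarith) (by linarith)

lemma two_mul_bdryDist_le (t : ℝ) : 2 * bdryDist t ≤ 3 := by
  have h3 : bdryDist t ≤ t + 1 := min_le_left _ _
  have h4 : bdryDist t ≤ 2 - t := min_le_right _ _
  linarith

lemma le_of_le_bdryDist {t r : ℝ} (h : r ≤ bdryDist t) : -1 ≤ t - r ∧ t + r ≤ 2 :=
  ⟨by linarith [h.trans (min_le_left _ _)], by linarith [h.trans (min_le_right _ _)]⟩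

/-- Scale-invariant power decay, with exponent `1 / 64` and constant `A`, of the energy of `f` on
squares well inside the strip `[-1, 2] × ℝ`. -/
def EnergyDecay (f : ℝ × ℝ → EuclideanSpace ℝ (Fin n)) (A : ℝ) : Prop :=
  ∀ (q : ℝ × ℝ) (s : ℝ), 0 < s → 2 * s ≤ bdryDist q.1 →
    energy f q s ≤ A * (s / bdryDist q.1) ^ (1 / 64 : ℝ)

lemma two_rpow_le : (2 : ℝ) ^ (1 / 64 : ℝ) ≤ 65 / 64 := by
  have h : (2 : ℝ) ≤ (65 / 64) ^ 64 := by
    norm_num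
  calc (2 : ℝ) ^ (1 / 64 : ℝ) ≤ ((65 / 64 : ℝ) ^ 64) ^ (1 / 64 : ℝ) :=
        Real.rpow_le_rpow (by norm_num) h (by norm_num)
    _ = 65 / 64 := by
        rw [one_div]
        exact_mod_cast Real.pow_rpow_inv_natCast (x := (65 / 64 : ℝ)) (n := 64) (by norm_num)
          (by norm_num)

lemma EnergyDecay.subsquare {A : ℝ} (hA : 0 ≤ A) (h : EnergyDecay f A) {p : ℝ × ℝ} {r : ℝ}
    (hr : 0 < r) (hrd : 4 * r ≤ bdryDist p.1) (q : ℝ × ℝ) (s : ℝ) (hs : 0 < s) (hsr : s ≤ r)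
    (hq : |q.1 - p.1| ≤ r - s) :
    energy f q s ≤ 2 * A * (r / bdryDist p.1) ^ (1 / 64 : ℝ) * (s / r) ^ (1 / 64 : ℝ) := by
  have h1 := bdryDist_sub_abs_le p.1 q.1
  have hd : 0 < bdryDist p.1 := by linarith
  have hd' : bdryDist p.1 / 2 ≤ bdryDist q.1 := by linarith
  have hd'' : 0 < bdryDist q.1 := by linarith
  calc energy f q s ≤ A * (s / bdryDist q.1) ^ (1 / 64 : ℝ) := h q s hs (by linarith)
    _ ≤ A * (s / (bdryDist p.1 / 2)) ^ (1 / 64 : ℝ) := by gcongr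
    _ = A * (2 * ((r / bdryDist p.1) * (s / r))) ^ (1 / 64 : ℝ) := by
        congr 2; field_simp
    _ = A * (2 ^ (1 / 64 : ℝ) *
          ((r / bdryDist p.1) ^ (1 / 64 : ℝ) * (s / r) ^ (1 / 64 : ℝ))) := by
        rw [Real.mul_rpow (by norm_num) (by positivity), Real.mul_rpow (by positivity)
          (by positivity)]
    _ ≤ A * (2 * ((r / bdryDist p.1) ^ (1 / 64 : ℝ) * (s / r) ^ (1 / 64 : ℝ))) := by
        gcongr
        exact two_rpow_le.trans (by norm_num)
    _ = _ := by ring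

lemma EnergyDecay.norm_sub_le (hf : ContDiff ℝ (⊤ : ℕ∞) f) {A : ℝ} (hA : 0 ≤ A)
    (h : EnergyDecay f A) {p : ℝ × ℝ} {r : ℝ} (hr : 0 < r) (hrd : 4 * r ≤ bdryDist p.1) :
    ∀ z ∈ square p r, ∀ w ∈ square p r,
      ‖f z - f w‖ ≤ 384 * √(2 * A * (r / bdryDist p.1) ^ (1 / 64 : ℝ)) := by
  have := norm_sub_le_of_energy_decay hf hr (by norm_num : (0 : ℝ) < 1 / 64)
    fun q s hs hsr hq _ => h.subsquare hA hr hrd q s hs hsr hq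
  norm_num at this ⊢
  exact this

lemma exists_energyDecay (hf : ContDiff ℝ (⊤ : ℕ∞) f)
    (hper : ∀ z, f (z + (0, 2 * π)) = f z) : ∃ A > 0, EnergyDecay f A := by
  have hg := continuous_gradSq hf
  obtain ⟨L, hL⟩ := ((isCompact_Icc (a := (-1 : ℝ)) (b := 2)).prod
    (isCompact_Icc (a := (0 : ℝ)) (b := 2 * π))).bddAbove_image hg.continuousOn
  have hL' : ∀ x ∈ Icc (-1 : ℝ) 2, ∀ y, gradSq f (x, y) ≤ L := by
    intro x hx y
    have hp : Function.Periodic (fun y => gradSq f (x, y)) (2 * π) := fun y => by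
      have := gradSq_periodic hper (x, y)
      simpa using this
    obtain ⟨y', hy', e⟩ := hp.exists_mem_Ico₀ Real.two_pi_pos y
    rw [e]
    exact hL ⟨(x, y'), ⟨hx, Ico_subset_Icc_self hy'⟩, rfl⟩
  have hL0 : 0 ≤ L := (gradSq_nonneg (f := f) (0, 0)).trans (hL' 0 (by norm_num) 0)
  refine ⟨5 * L + 1, by linarith, fun q s hs hsd => ?_⟩
  have hd : 0 < bdryDist q.1 := by linarith
  have hd3 := two_mul_bdryDist_le q.1
  obtain ⟨h1, h2⟩ := le_of_le_bdryDist (t := q.1) (r := s) (by linarith)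
  have hE : energy f q s ≤ ∫ z in square q s, L := by
    refine setIntegral_mono_on (integrableOn_square hg q s)
      (integrableOn_square continuous_const q s) (measurableSet_Icc.prod measurableSet_Icc)
      fun z hz => ?_
    exact hL' z.1 ⟨h1.trans hz.1.1, hz.1.2.trans h2⟩ z.2
  rw [setIntegral_const, measureReal_square q hs.le, smul_eq_mul] at hE
  have hsd1 : s / bdryDist q.1 ≤ 1 := (div_le_one hd).2 (by linarith)
  have hx : s / bdryDist q.1 ≤ (s / bdryDist q.1) ^ (1 / 64 : ℝ) :=
    Real.self_le_rpow_of_le_one (by positivity) hsd1 (by norm_num)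
  have hs' : 4 * s ^ 2 ≤ 5 * (s / bdryDist q.1) := by
    rw [← mul_div_assoc, le_div_iff₀ hd]
    nlinarith
  calc _ ≤ _ := hE
    _ ≤ 5 * (s / bdryDist q.1) * L := by gcongr
    _ = 5 * L * (s / bdryDist q.1) := by ring
    _ ≤ (5 * L + 1) * (s / bdryDist q.1) := by gcongr; linarith
    _ ≤ _ := by gcongr

/-- Under the smallness assumption on the Willmore energy, the decay constant improves. -/
lemma EnergyDecay.improve (hf : ContDiff ℝ (⊤ : ℕ∞) f)
    (hper : ∀ z, f (z + (0, 2 * π)) = f z) (hz : ∀ z, fderiv ℝ f z = 0 → lap f z = 0)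
    (hW : ∀ s ∈ Icc (-1 : ℝ) 1,
      willmore f (Icc s (s + 1) ×ˢ Icc 0 (2 * π)) < ENNReal.ofReal ((1 / 12288) ^ 2))
    {A : ℝ} (hA : 0 < A) (h : EnergyDecay f A) :
    EnergyDecay f (max (16 * ∫ z in Icc (-1 : ℝ) 2 ×ˢ Icc 0 (2 * π), gradSq f z)
      (131 / 132 * A)) := by
  intro q s hs hsd
  set E₀ := ∫ z in Icc (-1 : ℝ) 2 ×ˢ Icc 0 (2 * π), gradSq f z
  set d := bdryDist q.1 with hd_def
  set x := (s / d) ^ (1 / 64 : ℝ) with hx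
  have hd : 0 < d := by linarith
  have hd3 : 2 * d ≤ 3 := two_mul_bdryDist_le q.1
  have hx0 : 0 < x := by positivity
  rcases le_total d (8 * s) with hcase | hcase
  · obtain ⟨h1, h2⟩ := le_of_le_bdryDist (t := q.1) (r := s) (by linarith)
    have hE : energy f q s ≤ 2 * E₀ := energy_le_two_mul_strip hf hper h1 h2
    have h8 : 1 / 8 ≤ s / d := by rw [le_div_iff₀ hd]; linarith
    have hx8 : 1 / 8 ≤ x := h8.trans <| Real.self_le_rpow_of_le_one (by positivity)
      ((div_le_one hd).2 (by linarith)) (by norm_num)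
    have hE0 : 0 ≤ E₀ := integral_nonneg fun _ => gradSq_nonneg _
    calc energy f q s ≤ 16 * E₀ * (1 / 8) := by linarith
      _ ≤ 16 * E₀ * x := by gcongr
      _ ≤ _ := by gcongr; exact le_max_left _ _
  · set Y := 2 * A * (2 * s / d) ^ (1 / 64 : ℝ) with hY
    have hY0 : 0 < Y := by positivity
    have h2x : (2 * s / d) ^ (1 / 64 : ℝ) ≤ 65 / 64 * x := by
      rw [mul_div_assoc, Real.mul_rpow (by norm_num) (by positivity)]
      gcongr
      exact two_rpow_le
    have hosc := h.norm_sub_le hf hA.le (p := q) (r := 2 * s) (by linarith) (by linarith)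
    have hE2 : energy f q (2 * s) ≤ A * (2 * s / d) ^ (1 / 64 : ℝ) :=
      h q (2 * s) (by linarith) (by linarith)
    have hAx : A * (2 * s / d) ^ (1 / 64 : ℝ) ≤ A * (65 / 64 * x) := by gcongr
    have hE2Y : energy f q (2 * s) ≤ Y := by
      have : 0 ≤ A * (2 * s / d) ^ (1 / 64 : ℝ) := by positivity
      linarith
    obtain ⟨h1, h2⟩ := le_of_le_bdryDist (t := q.1) (r := 2 * s) (by linarith)
    have hlap := setIntegral_norm_lap_le hf hper hz (by norm_num) hW (p := q) (r := 2 * s)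
      (by linarith) h1 h2 hY0 hE2Y
    have hmain := energy_half_le hf hs hosc
    have hsq : √Y * √Y = Y := Real.mul_self_sqrt hY0.le
    have hprod : 384 * √Y * (∫ z in square q (2 * s), ‖lap f z‖) ≤
        384 * √Y * (2 * (1 / 12288) * √Y) := by gcongr
    have hYx : Y ≤ 4 * (A * x) := by
      have : 0 ≤ A * x := by positivity
      linarith
    have hfin : energy f q s ≤ 131 / 132 * A * x := by
      have e : 384 * √Y * (2 * (1 / 12288) * √Y) = 1 / 16 * Y := by
        linear_combination (1 / 16) * hsq
      rw [e] at hprod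
      linarith
    calc _ ≤ _ := hfin
      _ ≤ _ := by gcongr; exact le_max_right _ _

lemma energyDecay_of_willmore_lt (hf : ContDiff ℝ (⊤ : ℕ∞) f)
    (hper : ∀ z, f (z + (0, 2 * π)) = f z) (hz : ∀ z, fderiv ℝ f z = 0 → lap f z = 0)
    (hW : ∀ s ∈ Icc (-1 : ℝ) 1,
      willmore f (Icc s (s + 1) ×ˢ Icc 0 (2 * π)) < ENNReal.ofReal ((1 / 12288) ^ 2)) :
    EnergyDecay f (16 * ∫ z in Icc (-1 : ℝ) 2 ×ˢ Icc 0 (2 * π), gradSq f z) := by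
  obtain ⟨A, hA, hdec⟩ := exists_energyDecay hf hper
  have himp := fun {B : ℝ} => EnergyDecay.improve hf hper hz hW (A := B)
  have hM : 0 ≤ 16 * ∫ z in Icc (-1 : ℝ) 2 ×ˢ Icc 0 (2 * π), gradSq f z :=
    mul_nonneg (by norm_num) (integral_nonneg fun _ => gradSq_nonneg _)
  set M := 16 * ∫ z in Icc (-1 : ℝ) 2 ×ˢ Icc 0 (2 * π), gradSq f z
  have hk : ∀ k : ℕ, EnergyDecay f (max M ((131 / 132) ^ k * A)) := by
    intro k
    induction k with
    | zero =>
      intro q s hs hsd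
      refine (hdec q s hs hsd).trans ?_
      have : 0 < bdryDist q.1 := by linarith
      gcongr
      simp
    | succ k ih =>
      intro q s hs hsd
      refine (himp (lt_max_of_lt_right (by positivity)) ih q s hs hsd).trans ?_
      have : 0 < bdryDist q.1 := by linarith
      have hle : 131 / 132 * max M ((131 / 132) ^ k * A) ≤ max M ((131 / 132) ^ (k + 1) * A) := by
        rw [mul_max_of_nonneg _ _ (by norm_num : (0 : ℝ) ≤ 131 / 132)]
        exact max_le_max (by linarith) (le_of_eq (by ring))
      have := max_le (le_max_left _ _) hle
      gcongr
  intro q s hs hsd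
  have hlim : Tendsto (fun k : ℕ => max M ((131 / 132) ^ k * A) *
      (s / bdryDist q.1) ^ (1 / 64 : ℝ)) atTop (nhds (M * (s / bdryDist q.1) ^ (1 / 64 : ℝ))) := by
    have h1 : Tendsto (fun k : ℕ => (131 / 132 : ℝ) ^ k * A) atTop (nhds (0 * A)) :=
      (tendsto_pow_atTop_nhds_zero_of_lt_one (r := (131 / 132 : ℝ)) (by norm_num)
        (by norm_num)).mul_const A
    have h2 := ((tendsto_const_nhds (x := M)).max h1).mul_const
      ((s / bdryDist q.1) ^ (1 / 64 : ℝ))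
    rwa [zero_mul, max_eq_left hM] at h2
  exact ge_of_tendsto' hlim fun k => hk k q s hs hsd

lemma norm_sub_le_nat_mul {E : Type*} [SeminormedAddCommGroup E] {g : ℝ → E} {δ ω : ℝ}
    (h : ∀ x y, |x - y| ≤ δ → ‖g x - g y‖ ≤ ω) (hδ : 0 ≤ δ) (k : ℕ) :
    ∀ x y, |x - y| ≤ k * δ → ‖g x - g y‖ ≤ k * ω := by
  induction k with
  | zero =>
    intro x y hxy
    have : x = y := by
      rw [Nat.cast_zero, zero_mul] at hxy
      exact sub_eq_zero.1 (abs_nonpos_iff.1 hxy)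
    simp [this]
  | succ k ih =>
    intro x y hxy
    push_cast at hxy ⊢
    obtain ⟨h1, h2⟩ := abs_le.1 hxy
    have hk : (0 : ℝ) ≤ k * δ := by positivity
    obtain ⟨z, hz1, hz2⟩ : ∃ z, |x - z| ≤ k * δ ∧ |z - y| ≤ δ := by
      rcases le_total x y with hle | hle
      · refine ⟨min y (x + k * δ), ?_, ?_⟩ <;> rw [abs_le] <;>
          rcases min_cases y (x + k * δ) with ⟨e, _⟩ | ⟨e, _⟩ <;> rw [e] <;>
          constructor <;> linarith
      · refine ⟨max y (x - k * δ), ?_, ?_⟩ <;> rw [abs_le] <;>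
          rcases max_cases y (x - k * δ) with ⟨e, _⟩ | ⟨e, _⟩ <;> rw [e] <;>
          constructor <;> linarith
    have := norm_sub_le_norm_sub_add_norm_sub (g x) (g z) (g y)
    linarith [ih x z hz1, h z y hz2]

lemma norm_sub_circAvg_le (hfc : Continuous f) (hper : ∀ t θ : ℝ, f (t, θ + 2 * π) = f (t, θ))
    {t K : ℝ} (hK : ∀ θ θ', |θ - θ'| ≤ 2 * π → ‖f (t, θ) - f (t, θ')‖ ≤ K) (θ : ℝ) :
    ‖f (t, θ) - circAvg f t‖ ≤ K := by
  have hp : Function.Periodic (fun θ => f (t, θ)) (2 * π) := hper t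
  have hpi := Real.two_pi_pos
  have h1 := hp.intervalIntegral_add_eq 0 θ
  rw [zero_add] at h1
  have hc : Continuous fun θ' => f (t, θ') := by fun_prop
  have e : f (t, θ) - circAvg f t =
      (2 * π)⁻¹ • ∫ θ' in θ..(θ + 2 * π), (f (t, θ) - f (t, θ')) := by
    rw [intervalIntegral.integral_sub (by simp) (hc.intervalIntegrable _ _),
      intervalIntegral.integral_const, circAvg, h1, smul_sub, smul_smul, add_sub_cancel_left,
      inv_mul_cancel₀ hpi.ne', one_smul]
  have h2 : ‖∫ θ' in θ..(θ + 2 * π), (f (t, θ) - f (t, θ'))‖ ≤ K * |θ + 2 * π - θ| := by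
    refine intervalIntegral.norm_integral_le_of_norm_le_const fun θ' hθ' => hK θ θ' ?_
    rw [uIoc_of_le (by linarith)] at hθ'
    rw [abs_le]
    constructor <;> linarith [hθ'.1, hθ'.2]
  rw [add_sub_cancel_left, abs_of_pos hpi] at h2
  rw [e, norm_smul, norm_inv, Real.norm_of_nonneg hpi.le, inv_mul_le_iff₀ hpi]
  linarith

end Decay

/-- Sup-norm bound for the deviation from the circle average (estimate (f*) in
Proposition 2.3). -/
theorem deviation_from_circle_average (n : ℕ) (hn : 1 ≤ n) :
    ∃ ε₀ > (0:ℝ), ∃ C > (0:ℝ),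
      ∀ f : ℝ × ℝ → EuclideanSpace ℝ (Fin n),
        ContDiff ℝ (⊤ : ℕ∞) f →
        (∀ t θ : ℝ, f (t, θ + 2 * π) = f (t, θ)) →
        (∀ z, fderiv ℝ f z = 0 → lap f z = 0) →
        (∀ s ∈ Icc (-1 : ℝ) 1,
            willmore f (Icc s (s + 1) ×ˢ Icc 0 (2 * π)) < ENNReal.ofReal (ε₀ ^ 2)) →
        ∀ t ∈ Icc (0:ℝ) 1, ∀ θ : ℝ,
          ‖f (t, θ) - circAvg f t‖ ≤
            C * Real.sqrt (∫ z in Icc (-1 : ℝ) 2 ×ˢ Icc 0 (2 * π), gradSq f z) := by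
  refine ⟨1 / 12288, by norm_num, 26 * (384 * 6), by norm_num, ?_⟩
  intro f hf hper hz hW t ht θ
  have hper' : ∀ z, f (z + (0, 2 * π)) = f z := fun z => by
    have := hper z.1 z.2
    simpa [Prod.add_def] using this
  have hdec := energyDecay_of_willmore_lt hf hper' hz hW
  have hE0 : 0 ≤ ∫ z in Icc (-1 : ℝ) 2 ×ˢ Icc 0 (2 * π), gradSq f z :=
    integral_nonneg fun _ => gradSq_nonneg _
  set E₀ := ∫ z in Icc (-1 : ℝ) 2 ×ˢ Icc 0 (2 * π), gradSq f z
  have hd : 1 ≤ bdryDist t := le_min (by linarith [ht.1]) (by linarith [ht.2])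
  have hloc : ∀ θ θ' : ℝ, |θ - θ'| ≤ 1 / 4 → ‖f (t, θ) - f (t, θ')‖ ≤ 384 * (6 * √E₀) := by
    intro θ θ' hθ
    obtain ⟨h1, h2⟩ := abs_le.1 hθ
    have h := hdec.norm_sub_le hf (by positivity) (p := (t, θ)) (r := 1 / 4) (by norm_num)
      (by dsimp only; linarith) (t, θ)
      ⟨⟨by dsimp only; linarith, by dsimp only; linarith⟩, by dsimp only; linarith,
        by dsimp only; linarith⟩ (t, θ')
      ⟨⟨by dsimp only; linarith, by dsimp only; linarith⟩, by dsimp only; linarith,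
        by dsimp only; linarith⟩
    refine h.trans ?_
    gcongr
    rw [Real.sqrt_le_left (by positivity), mul_pow, Real.sq_sqrt hE0]
    have : (1 / 4 / bdryDist t) ^ (1 / 64 : ℝ) ≤ 1 :=
      Real.rpow_le_one (by positivity) ((div_le_one (by linarith)).2 (by linarith)) (by norm_num)
    calc 2 * (16 * E₀) * (1 / 4 / bdryDist t) ^ (1 / 64 : ℝ) ≤ 2 * (16 * E₀) * 1 := by gcongr
      _ ≤ _ := by linarith
  have hglob := norm_sub_le_nat_mul hloc (by norm_num) 26
  refine norm_sub_circAvg_le hf.continuous hper (fun θ θ' h => ?_) θ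
  refine (hglob θ θ' (h.trans ?_)).trans_eq ?_
  · push_cast
    linarith [Real.pi_lt_d2]
  · push_cast
    ring
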